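/- Let f = a/b ∈ K(x) with gcd(a,b)=1 and q not a root of unity. Then f is rational q-summable in K(x) if and only if the q-discrete residue of f at infinity is zero and the q-discrete residue qres_x(f,[β]_q,j) is zero for every q^Z-orbit [β]_q of nonzero roots β of b and every multiplicity j. -/

import Mathlib

open Polynomial

/-- `τ` is the automorphism `f(x) ↦ f(q x)` of the field of rational functions. -/
structure IsQShift {K : Type*} [Field K] (q : K) (τ : RatFunc K →+* RatFunc K) : Prop where
  map_C : ∀ e : K, τ (RatFunc.C e) = RatFunc.C e
  map_X : τ RatFunc.X = RatFunc.C q * RatFunc.X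

theorem IsQShift.map_algebraMap {K : Type*} [Field K] {q : K} {τ : RatFunc K →+* RatFunc K}
    (hτ : IsQShift q τ) (p : K[X]) :
    τ (algebraMap K[X] (RatFunc K) p) = algebraMap K[X] (RatFunc K) (p.comp (C q * X)) := by
  induction p using Polynomial.induction_on' with
  | add p r hp hr => simp [hp, hr]
  | monomial n a =>
    simp [← C_mul_X_pow_eq_monomial, RatFunc.algebraMap_C, RatFunc.algebraMap_X, hτ.map_C,
      hτ.map_X]

theorem comp_C_mul_X_ne_zero {K : Type*} [Field K] {q : K} (hq0 : q ≠ 0) {p : K[X]}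
    (hp : p ≠ 0) : p.comp (C q * X) ≠ 0 := by
  intro h
  apply hp
  ext n
  have := congrArg (fun r => coeff r n) h
  simpa [comp_C_mul_X_coeff, hq0] using this

theorem exists_isQShift {K : Type*} [Field K] {q : K} (hq0 : q ≠ 0) :
    ∃ τ : RatFunc K →+* RatFunc K, IsQShift q τ := by
  have hle : nonZeroDivisors K[X] ≤ (nonZeroDivisors K[X]).comap (compRingHom (C q * X)) := by
    intro p hp
    rw [Submonoid.mem_comap, mem_nonZeroDivisors_iff_ne_zero]
    exact comp_C_mul_X_ne_zero hq0 (nonZeroDivisors.ne_zero hp)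
  have key (p : K[X]) : RatFunc.mapRingHom (compRingHom (C q * X)) hle (algebraMap _ _ p) =
      algebraMap K[X] (RatFunc K) (p.comp (C q * X)) := by
    have := RatFunc.map_apply_div (compRingHom (C q * X)) hle p 1
    simpa [RatFunc.coe_mapRingHom_eq_coe_map] using this
  refine ⟨RatFunc.mapRingHom (compRingHom (C q * X)) hle, fun e => ?_, ?_⟩
  · simpa using key (C e)
  · simpa using key X

theorem map_algebraMap_of_map_C_of_map_X {K L : Type*} [Field K] [Field L] [Algebra K L]
    {ι : RatFunc K →+* RatFunc L}
    (hιC : ∀ c : K, ι (RatFunc.C c) = RatFunc.C (algebraMap K L c))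
    (hιX : ι RatFunc.X = RatFunc.X) (p : K[X]) :
    ι (algebraMap K[X] (RatFunc K) p) = algebraMap L[X] (RatFunc L) (p.map (algebraMap K L)) := by
  induction p using Polynomial.induction_on' with
  | add p r hp hr => simp [hp, hr]
  | monomial n a =>
    simp [← C_mul_X_pow_eq_monomial, RatFunc.algebraMap_C, RatFunc.algebraMap_X, hιC, hιX]

theorem zpow_eq_one_iff_of_pow_ne_one {K : Type*} [Field K] {q : K}
    (hq : ∀ n : ℕ, 0 < n → q ^ n ≠ 1) {z : ℤ} (hz : q ^ z = 1) : z = 0 := by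
  by_contra h
  apply hq z.natAbs (Int.natAbs_pos.2 h)
  rcases Int.natAbs_eq z with h' | h' <;> rw [h'] at hz
  · rwa [zpow_natCast] at hz
  · rwa [zpow_neg, zpow_natCast, inv_eq_one] at hz

section Descent

variable {K L : Type*} [Field K] [Field L] [Algebra K L]

/-- Apply a linear form `L → K` to all coefficients of a polynomial. -/
noncomputable def mapCoeffs (π : L →ₗ[K] K) (p : L[X]) : K[X] :=
  ∑ i ∈ p.support, monomial i (π (p.coeff i))

@[simp]
theorem coeff_mapCoeffs (π : L →ₗ[K] K) (p : L[X]) (k : ℕ) :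
    (mapCoeffs π p).coeff k = π (p.coeff k) := by
  simp only [mapCoeffs, finsetSum_coeff, coeff_monomial, Finset.sum_ite_eq']
  split_ifs with h
  · rfl
  · rw [notMem_support_iff.1 h, map_zero]

theorem mapCoeffs_sub (π : L →ₗ[K] K) (p r : L[X]) :
    mapCoeffs π (p - r) = mapCoeffs π p - mapCoeffs π r := by
  ext k; simp

theorem mapCoeffs_map_mul (π : L →ₗ[K] K) (r : K[X]) (p : L[X]) :
    mapCoeffs π (r.map (algebraMap K L) * p) = r * mapCoeffs π p := by
  ext k
  simp [coeff_mul, ← Algebra.smul_def]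

theorem mapCoeffs_comp (π : L →ₗ[K] K) (q : K) (p : L[X]) :
    mapCoeffs π (p.comp (C (algebraMap K L q) * X)) = (mapCoeffs π p).comp (C q * X) := by
  ext k
  simp only [coeff_mapCoeffs, comp_C_mul_X_coeff]
  rw [mul_comm, ← map_pow, ← Algebra.smul_def, map_smul, smul_eq_mul, mul_comm]

theorem exists_shift_sub_self_of_map [Algebra.IsAlgebraic K L]
    {q : K} (hq0 : q ≠ 0) {τ : RatFunc K →+* RatFunc K} (hτ : IsQShift q τ)
    {σ : RatFunc L →+* RatFunc L} (hσ : IsQShift (algebraMap K L q) σ)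
    {ι : RatFunc K →+* RatFunc L}
    (hιC : ∀ c : K, ι (RatFunc.C c) = RatFunc.C (algebraMap K L c))
    (hιX : ι RatFunc.X = RatFunc.X) {f : RatFunc K} {G : RatFunc L} (h : ι f = σ G - G) :
    ∃ g : RatFunc K, f = τ g - g := by
  obtain ⟨π, hπ⟩ := LinearMap.exists_leftInverse_of_injective (Algebra.linearMap K L)
    (LinearMap.ker_eq_bot.2 (algebraMap K L).injective)
  have hπ1 : π 1 = 1 := by simpa using LinearMap.congr_fun hπ 1
  obtain ⟨N, hN0, B, hB⟩ : ∃ N : K[X], N ≠ 0 ∧ G.denom ∣ N.map (algebraMap K L) :=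
    Polynomial.exists_dvd_map_of_isAlgebraic G.denom_ne_zero
  set j := algebraMap K L
  have hNj : N.map j ≠ 0 := (Polynomial.map_ne_zero_iff j.injective).2 hN0
  have hNq := comp_C_mul_X_ne_zero hq0 hN0
  have hNqj : (N.map j).comp (C (j q) * X) = (N.comp (C q * X)).map j := by
    simp [Polynomial.map_comp]
  have hNqj0 : (N.comp (C q * X)).map j ≠ 0 := (Polynomial.map_ne_zero_iff j.injective).2 hNq
  have hv : f.denom.map j ≠ 0 := (Polynomial.map_ne_zero_iff j.injective).2 f.denom_ne_zero
  have inj (p : L[X]) (hp : p ≠ 0) : algebraMap L[X] (RatFunc L) p ≠ 0 :=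
    RatFunc.algebraMap_ne_zero hp
  have injK (p : K[X]) (hp : p ≠ 0) : algebraMap K[X] (RatFunc K) p ≠ 0 :=
    RatFunc.algebraMap_ne_zero hp
  have hG : G = algebraMap L[X] (RatFunc L) (G.num * B) / algebraMap _ _ (N.map j) := by
    have hB0 : B ≠ 0 := by rintro rfl; simp [hB] at hNj
    rw [hB, map_mul, map_mul, mul_div_mul_right _ _ (inj _ hB0), RatFunc.num_div_denom]
  generalize G.num * B = A at hG
  have hι (p : K[X]) : ι (algebraMap _ _ p) = algebraMap _ _ (p.map j) :=
    map_algebraMap_of_map_C_of_map_X hιC hιX p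
  have hpoly : (N.comp (C q * X) * N * f.num).map j * 1 =
      (f.denom * N).map j * A.comp (C (j q) * X) -
        (f.denom * N.comp (C q * X)).map j * A := by
    apply RatFunc.algebraMap_injective L
    rw [← RatFunc.num_div_denom f, map_div₀, hι, hι, hG, map_div₀, hσ.map_algebraMap,
      hσ.map_algebraMap, hNqj] at h
    field_simp [inj _ hv, inj _ hNj, inj _ hNqj0] at h
    simp only [Polynomial.map_mul, map_mul, map_sub, mul_one]
    linear_combination h
  have hpoly' := congrArg (mapCoeffs π) hpoly
  have hone : mapCoeffs π (1 : L[X]) = 1 := by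
    ext k; simp only [coeff_mapCoeffs, coeff_one]; split_ifs <;> simp [hπ1]
  rw [mapCoeffs_sub, mapCoeffs_map_mul, mapCoeffs_map_mul, mapCoeffs_map_mul, mapCoeffs_comp,
    hone] at hpoly'
  refine ⟨algebraMap _ _ (mapCoeffs π A) / algebraMap _ _ N, ?_⟩
  have hK := congrArg (algebraMap K[X] (RatFunc K)) hpoly'
  rw [map_div₀, hτ.map_algebraMap, hτ.map_algebraMap]
  nth_rw 1 [← RatFunc.num_div_denom f]
  simp only [map_mul, map_sub, mul_one] at hK
  field_simp [injK _ f.denom_ne_zero, injK _ hN0, injK _ hNq]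
  linear_combination hK

end Descent

section Poles

variable {L : Type*} [Field L]

/-- The rational function `F` has no pole at `γ`. -/
def RegularAt (γ : L) (F : RatFunc L) : Prop := F.denom.eval γ ≠ 0

theorem regularAt_of_denom_dvd {γ : L} {F : RatFunc L} {B : L[X]} (h : F.denom ∣ B)
    (hB : B.eval γ ≠ 0) : RegularAt γ F :=
  fun h0 => hB (eval_eq_zero_of_dvd_of_eval_eq_zero h h0)

theorem regularAt_div {γ : L} (A : L[X]) {B : L[X]} (hB : B.eval γ ≠ 0) :
    RegularAt γ (algebraMap L[X] (RatFunc L) A / algebraMap _ _ B) :=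
  regularAt_of_denom_dvd (RatFunc.denom_div_dvd A B) hB

theorem regularAt_C (γ e : L) : RegularAt γ (RatFunc.C e) := by
  simp [RegularAt]

theorem RegularAt.add {γ : L} {F G : RatFunc L} (hF : RegularAt γ F) (hG : RegularAt γ G) :
    RegularAt γ (F + G) :=
  regularAt_of_denom_dvd (RatFunc.denom_add_dvd F G) (by simpa using ⟨hF, hG⟩)

theorem RegularAt.mul {γ : L} {F G : RatFunc L} (hF : RegularAt γ F) (hG : RegularAt γ G) :
    RegularAt γ (F * G) :=
  regularAt_of_denom_dvd (RatFunc.denom_mul_dvd F G) (by simpa using ⟨hF, hG⟩)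

theorem RegularAt.sub {γ : L} {F G : RatFunc L} (hF : RegularAt γ F) (hG : RegularAt γ G) :
    RegularAt γ (F - G) := by
  have := hF.add ((regularAt_C γ (-1)).mul hG)
  simpa [sub_eq_add_neg] using this

theorem RegularAt.sum {γ : L} {κ : Type*} {t : Finset κ} {F : κ → RatFunc L}
    (h : ∀ i ∈ t, RegularAt γ (F i)) : RegularAt γ (∑ i ∈ t, F i) :=
  Finset.sum_induction F (RegularAt γ) (fun _ _ => RegularAt.add)
    (by simpa using regularAt_C γ 0) h

theorem algebraMap_X_sub_C (β : L) :
    algebraMap L[X] (RatFunc L) (X - C β) = RatFunc.X - RatFunc.C β := by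
  simp [RatFunc.algebraMap_C, RatFunc.algebraMap_X]

theorem ratFunc_X_sub_C_ne_zero (β : L) : (RatFunc.X - RatFunc.C β : RatFunc L) ≠ 0 := by
  rw [← algebraMap_X_sub_C]
  exact RatFunc.algebraMap_ne_zero (X_sub_C_ne_zero β)

theorem regularAt_C_div_X_sub_C_pow {γ β : L} (h : γ ≠ β) (a : L) (k : ℕ) :
    RegularAt γ (RatFunc.C a / (RatFunc.X - RatFunc.C β) ^ k) := by
  have := regularAt_div (γ := γ) (C a) (B := (X - C β) ^ k) (by simp [sub_ne_zero.2 h])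
  rwa [map_pow, algebraMap_X_sub_C, RatFunc.algebraMap_C] at this

theorem regularAt_X_sub_C_pow (γ β : L) (k : ℕ) :
    RegularAt γ ((RatFunc.X - RatFunc.C β) ^ k) := by
  have := regularAt_div (γ := γ) ((X - C β) ^ k) (B := 1) (by simp)
  rwa [map_pow, algebraMap_X_sub_C, map_one, div_one] at this

theorem eq_zero_of_regularAt_C_div {β a : L}
    (h : RegularAt β (RatFunc.C a / (RatFunc.X - RatFunc.C β))) : a = 0 := by
  set F := RatFunc.C a / (RatFunc.X - RatFunc.C β) with hF
  have h1 : F * (RatFunc.X - RatFunc.C β) = RatFunc.C a :=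
    div_mul_cancel₀ _ (ratFunc_X_sub_C_ne_zero β)
  rw [← RatFunc.num_div_denom F, div_mul_eq_mul_div,
    div_eq_iff (RatFunc.algebraMap_ne_zero F.denom_ne_zero), ← algebraMap_X_sub_C,
    ← RatFunc.algebraMap_C, ← map_mul, ← map_mul] at h1
  have h2 := congrArg (eval β) (RatFunc.algebraMap_injective L h1)
  simp only [eval_mul, eval_sub, eval_X, eval_C, sub_self, mul_zero] at h2
  exact (mul_eq_zero.1 h2.symm).resolve_right h

theorem eq_zero_of_regularAt_principal_part {β : L} {r : ℕ → L} {n : ℕ}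
    (h : RegularAt β (∑ j ∈ Finset.range n,
      RatFunc.C (r j) / (RatFunc.X - RatFunc.C β) ^ (j + 1))) :
    ∀ j < n, r j = 0 := by
  induction n with
  | zero => simp
  | succ n ih =>
    have ht := ratFunc_X_sub_C_ne_zero β
    have hn : r n = 0 := by
      apply eq_zero_of_regularAt_C_div (β := β)
      have h1 := (regularAt_X_sub_C_pow β β n).mul h
      have h2 : RegularAt β (∑ j ∈ Finset.range n,
          RatFunc.C (r j) * (RatFunc.X - RatFunc.C β) ^ (n - (j + 1))) :=
        RegularAt.sum fun j _ => (regularAt_C _ _).mul (regularAt_X_sub_C_pow _ _ _)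
      convert h1.sub h2 using 1
      rw [Finset.mul_sum, Finset.sum_range_succ, add_sub_right_comm, ← Finset.sum_sub_distrib,
        Finset.sum_eq_zero, zero_add]
      · rw [pow_succ]; field_simp
      · intro j hj
        have hj' : n = (n - (j + 1)) + (j + 1) := by
          have := Finset.mem_range.1 hj; omega
        rw [sub_eq_zero]
        nth_rw 1 [hj', pow_add]
        field_simp
    rw [Finset.sum_range_succ, hn, map_zero, zero_div, add_zero] at h
    intro j hj
    rcases Nat.lt_succ_iff_lt_or_eq.1 hj with hj | rfl
    · exact ih h j hj
    · exact hn

theorem IsQShift.regularAt {q : L} (hq0 : q ≠ 0) {σ : RatFunc L →+* RatFunc L}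
    (hσ : IsQShift q σ) {γ : L} {F : RatFunc L} :
    RegularAt γ (σ F) ↔ RegularAt (q * γ) F := by
  constructor
  · intro h
    have hden : ((σ F).denom).comp (C q⁻¹ * X) ≠ 0 :=
      comp_C_mul_X_ne_zero (inv_ne_zero hq0) (RatFunc.denom_ne_zero _)
    have key : (F : RatFunc L) = algebraMap L[X] (RatFunc L) ((σ F).num.comp (C q⁻¹ * X)) /
        algebraMap _ _ ((σ F).denom.comp (C q⁻¹ * X)) := by
      apply σ.injective
      rw [map_div₀, hσ.map_algebraMap, hσ.map_algebraMap, comp_assoc, comp_assoc]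
      have : (C q⁻¹ * X : L[X]).comp (C q * X) = X := by
        simp [← mul_assoc, ← C_mul, hq0]
      rw [this, comp_X, comp_X, RatFunc.num_div_denom]
    rw [key]
    apply regularAt_div
    simpa [eval_comp, hq0, RegularAt] using h
  · intro h
    rw [← RatFunc.num_div_denom F, map_div₀, hσ.map_algebraMap, hσ.map_algebraMap]
    apply regularAt_div
    simpa [eval_comp, RegularAt] using h

end Poles

section Telescoping

variable {L : Type*} [Field L] {q : L} {σ : RatFunc L →+* RatFunc L}

theorem not_forall_nat_not_regularAt {F : RatFunc L} {γ : ℕ → L} (hγ : Function.Injective γ) :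
    ¬ ∀ k, ¬ RegularAt (γ k) F := by
  intro h
  refine F.denom_ne_zero (eq_zero_of_infinite_isRoot _
    ((Set.infinite_range_of_injective hγ).mono ?_))
  rintro _ ⟨k, rfl⟩
  exact not_not.1 (h k)

/-- If all poles of `σ G - G` lie in pairwise distinct orbits, then `G` has no nonzero poles. -/
theorem regularAt_of_sub_regularAt (hq0 : q ≠ 0) (hq : ∀ n : ℕ, 0 < n → q ^ n ≠ 1)
    (hσ : IsQShift q σ) {G : RatFunc L} {S : Set L}
    (hS : ∀ β ∈ S, ∀ z : ℤ, q ^ z * β ∈ S → z = 0)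
    (hG : ∀ γ ∉ S, RegularAt γ (σ G - G)) {γ : L} (hγ : γ ≠ 0) : RegularAt γ G := by
  have step (δ : L) (hδ : δ ∉ S) : RegularAt (q * δ) G ↔ RegularAt δ G := by
    rw [← hσ.regularAt hq0]
    constructor
    · intro h; simpa using h.sub (hG δ hδ)
    · intro h; simpa using h.add (hG δ hδ)
  have hinj : Function.Injective fun z : ℤ => q ^ z * γ := by
    intro y z hyz
    have h1 : q ^ (y - z) = 1 := by
      rw [zpow_sub₀ hq0, mul_right_cancel₀ hγ hyz, div_self (zpow_ne_zero _ hq0)]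
    have := zpow_eq_one_iff_of_pow_ne_one hq h1
    omega
  by_contra hbad
  by_cases hfwd : ∀ k : ℕ, q ^ (k : ℤ) * γ ∉ S
  · refine not_forall_nat_not_regularAt (F := G) (γ := fun k : ℕ => q ^ (k : ℤ) * γ)
      (hinj.comp Nat.cast_injective) fun k => ?_
    induction k with
    | zero => simpa using hbad
    | succ k ih =>
      have := step _ (hfwd k)
      rw [← mul_assoc, ← zpow_one_add₀ hq0, add_comm] at this
      push_cast
      rwa [this]
  · push Not at hfwd
    obtain ⟨k₀, hk₀⟩ := hfwd
    have hback (k : ℕ) : q ^ (-((k : ℤ) + 1)) * γ ∉ S := by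
      intro hmem
      have := hS _ hk₀ (-((k : ℤ) + 1) - k₀) (by
        rwa [← mul_assoc, ← zpow_add₀ hq0, sub_add_cancel])
      omega
    refine not_forall_nat_not_regularAt (F := G) (γ := fun k : ℕ => q ^ (-(k : ℤ)) * γ)
      (hinj.comp (neg_injective.comp Nat.cast_injective)) fun k => ?_
    induction k with
    | zero => simpa using hbad
    | succ k ih =>
      have := step _ (hback k)
      rw [← mul_assoc, ← zpow_one_add₀ hq0, neg_add_rev, add_neg_cancel_left] at this
      push_cast
      rwa [neg_add_rev, ← this]

theorem eq_zero_of_C_eq_shift_sub_self [IsAlgClosed L] (hq0 : q ≠ 0) (hσ : IsQShift q σ)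
    {G : RatFunc L} {c : L} (hG : ∀ γ ≠ 0, RegularAt γ G) (h : RatFunc.C c = σ G - G) :
    c = 0 := by
  obtain ⟨u, e, hu, hden⟩ : ∃ (u : L) (e : ℕ), u ≠ 0 ∧ G.denom = C u * X ^ e := by
    refine ⟨_, G.denom.roots.card, leadingCoeff_ne_zero.2 G.denom_ne_zero, ?_⟩
    have hroots : G.denom.roots = Multiset.replicate G.denom.roots.card 0 := by
      refine Multiset.eq_replicate_card.2 fun γ hγ => ?_
      by_contra h0
      exact hG γ h0 ((mem_roots G.denom_ne_zero).1 hγ)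
    have hsplit := (IsAlgClosed.splits G.denom).eq_prod_roots
    rw [hroots] at hsplit
    simpa using hsplit
  have hX : (RatFunc.X : RatFunc L) ≠ 0 := RatFunc.X_ne_zero
  have hC {e : L} (he : e ≠ 0) : (RatFunc.C e : RatFunc L) ≠ 0 := by simpa using he
  have hGe : G = algebraMap L[X] (RatFunc L) G.num / (RatFunc.C u * RatFunc.X ^ e) := by
    conv_lhs => rw [← RatFunc.num_div_denom G, hden]
    simp [RatFunc.algebraMap_C, RatFunc.algebraMap_X]
  generalize G.num = A at hGe
  rw [hGe, map_div₀, hσ.map_algebraMap, map_mul, map_pow, hσ.map_C, hσ.map_X] at h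
  have hpoly : C (c * u * q ^ e) * X ^ e = A.comp (C q * X) - C (q ^ e) * A := by
    apply RatFunc.algebraMap_injective L
    have hu' := hC hu
    have hq' := hC hq0
    rw [mul_pow] at h
    field_simp at h
    simp only [map_mul, map_sub, map_pow, RatFunc.algebraMap_C, RatFunc.algebraMap_X]
    linear_combination h
  have := congrArg (fun p => coeff p e) hpoly
  simp only [coeff_C_mul, coeff_X_pow_self, coeff_sub, comp_C_mul_X_coeff] at this
  have h0 : c * u * q ^ e = 0 := by linear_combination this
  simpa [hq0, hu] using h0

variable (σ) in
/-- The rational functions of the form `σ g - g`. -/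
noncomputable def summables : AddSubgroup (RatFunc L) :=
  ((σ : RatFunc L →+ RatFunc L) - AddMonoidHom.id (RatFunc L)).range

theorem mem_summables {F : RatFunc L} : F ∈ summables σ ↔ ∃ G, F = σ G - G := by
  simp [summables, eq_comm]

theorem C_mul_X_zpow_mem_summables (hq : ∀ n : ℕ, 0 < n → q ^ n ≠ 1)
    (hσ : IsQShift q σ) (a : L) {k : ℤ} (hk : k ≠ 0) :
    RatFunc.C a * RatFunc.X ^ k ∈ summables σ := by
  have h : q ^ k - 1 ≠ 0 := fun h0 =>
    hk (zpow_eq_one_iff_of_pow_ne_one hq (sub_eq_zero.1 h0))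
  refine mem_summables.2 ⟨RatFunc.C (a / (q ^ k - 1)) * RatFunc.X ^ k, ?_⟩
  have hC : (RatFunc.C a : RatFunc L) =
      RatFunc.C (a / (q ^ k - 1)) * (RatFunc.C q ^ k - 1) := by
    rw [← map_zpow₀, ← map_one RatFunc.C, ← map_sub, ← map_mul, div_mul_cancel₀ _ h]
  rw [map_mul, hσ.map_C, map_zpow₀, hσ.map_X, mul_zpow, hC]
  ring

theorem X_mul_mem_summables (hq : ∀ n : ℕ, 0 < n → q ^ n ≠ 1)
    (hσ : IsQShift q σ) (p : L[X]) :
    RatFunc.X * algebraMap L[X] (RatFunc L) p ∈ summables σ := by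
  rw [p.as_sum_range_C_mul_X_pow, map_sum, Finset.mul_sum]
  refine sum_mem fun k _ => ?_
  convert C_mul_X_zpow_mem_summables hq hσ (p.coeff k) (k := (k + 1 : ℕ)) (by omega) using 1
  rw [zpow_natCast, map_mul, map_pow, RatFunc.algebraMap_C, RatFunc.algebraMap_X]
  ring

theorem div_X_pow_mem_summables (hq : ∀ n : ℕ, 0 < n → q ^ n ≠ 1)
    (hσ : IsQShift q σ) {p : L[X]} {s : ℕ} (hp : p.natDegree < s) :
    algebraMap L[X] (RatFunc L) p / RatFunc.X ^ s ∈ summables σ := by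
  rw [p.as_sum_range' s hp, map_sum, Finset.sum_div]
  refine sum_mem fun k hk => ?_
  have hk := Finset.mem_range.1 hk
  convert C_mul_X_zpow_mem_summables hq hσ (p.coeff k) (k := (k : ℤ) - s) (by omega) using 1
  rw [zpow_sub₀ RatFunc.X_ne_zero, zpow_natCast, zpow_natCast, ← C_mul_X_pow_eq_monomial, map_mul,
    map_pow, RatFunc.algebraMap_C, RatFunc.algebraMap_X, mul_div_assoc]

theorem shift_C_div_X_sub_C_pow (hq0 : q ≠ 0) (hσ : IsQShift q σ) (a γ : L) (k : ℕ) :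
    σ (RatFunc.C a / (RatFunc.X - RatFunc.C (q * γ)) ^ k) =
      RatFunc.C (q⁻¹ ^ k * a) / (RatFunc.X - RatFunc.C γ) ^ k := by
  have hC : (RatFunc.C q : RatFunc L) ≠ 0 := by simpa using hq0
  have ht := ratFunc_X_sub_C_ne_zero γ
  rw [map_div₀, map_pow, map_sub, hσ.map_C, hσ.map_C, hσ.map_X, map_mul, ← mul_sub, mul_pow,
    map_mul, map_pow, map_inv₀, inv_pow]
  field_simp

theorem C_div_sub_C_div_mem_summables (hq0 : q ≠ 0) (hσ : IsQShift q σ) (a β : L) (k ℓ : ℕ) :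
    RatFunc.C a / (RatFunc.X - RatFunc.C (q ^ ℓ * β)) ^ k -
      RatFunc.C (q⁻¹ ^ (ℓ * k) * a) / (RatFunc.X - RatFunc.C β) ^ k ∈ summables σ := by
  induction ℓ generalizing a with
  | zero => simp
  | succ ℓ ih =>
    have h1 : RatFunc.C a / (RatFunc.X - RatFunc.C (q ^ (ℓ + 1) * β)) ^ k -
        RatFunc.C (q⁻¹ ^ k * a) / (RatFunc.X - RatFunc.C (q ^ ℓ * β)) ^ k ∈ summables σ := by
      rw [← neg_mem_iff, neg_sub, mem_summables]
      refine ⟨_, congrArg₂ _ (shift_C_div_X_sub_C_pow hq0 hσ a (q ^ ℓ * β) k).symm ?_⟩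
      rw [pow_succ', mul_assoc]
    have h2 := add_mem h1 (ih (q⁻¹ ^ k * a))
    rwa [sub_add_sub_cancel, ← mul_assoc, ← pow_add, ← Nat.succ_mul] at h2

theorem sum_C_div_mem_summables_iff [IsAlgClosed L] (hq0 : q ≠ 0)
    (hq : ∀ n : ℕ, 0 < n → q ^ n ≠ 1) (hσ : IsQShift q σ) {m : ℕ} (n : Fin m → ℕ)
    (r : Fin m → ℕ → L) (β : Fin m → L) (hβ0 : ∀ i, β i ≠ 0)
    (hβ : ∀ i i' : Fin m, i ≠ i' → ∀ z : ℤ, β i ≠ q ^ z * β i') (c : L) :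
    RatFunc.C c + ∑ i, ∑ j ∈ Finset.range (n i),
        RatFunc.C (r i j) / (RatFunc.X - RatFunc.C (β i)) ^ (j + 1) ∈ summables σ ↔
      c = 0 ∧ ∀ i, ∀ j ∈ Finset.range (n i), r i j = 0 := by
  constructor
  · intro h
    obtain ⟨G, hG⟩ := mem_summables.1 h
    have hS : ∀ γ ∈ Set.range β, ∀ z : ℤ, q ^ z * γ ∈ Set.range β → z = 0 := by
      rintro _ ⟨i, rfl⟩ z ⟨i', hi'⟩
      have hii : i' = i := by
        by_contra hne
        exact hβ i' i hne z hi'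
      subst hii
      exact zpow_eq_one_iff_of_pow_ne_one hq (mul_eq_right₀ (hβ0 i') |>.1 hi'.symm)
    have hreg : ∀ γ ≠ 0, RegularAt γ G := by
      intro γ hγ
      refine regularAt_of_sub_regularAt hq0 hq hσ hS (fun δ hδ => ?_) hγ
      rw [← hG]
      refine (regularAt_C _ _).add (RegularAt.sum fun i _ => RegularAt.sum fun j _ => ?_)
      exact regularAt_C_div_X_sub_C_pow (fun h => hδ ⟨i, h.symm⟩) _ _
    have hr : ∀ i, ∀ j ∈ Finset.range (n i), r i j = 0 := by
      intro i j hj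
      refine eq_zero_of_regularAt_principal_part (β := β i) (r := r i) (n := n i) ?_ j
        (Finset.mem_range.1 hj)
      have h1 : RegularAt (β i) (σ G - G) :=
        ((hσ.regularAt hq0).2 (hreg _ (mul_ne_zero hq0 (hβ0 i)))).sub (hreg _ (hβ0 i))
      have h2 : RegularAt (β i) (∑ i' ∈ Finset.univ.erase i, ∑ j ∈ Finset.range (n i'),
          RatFunc.C (r i' j) / (RatFunc.X - RatFunc.C (β i')) ^ (j + 1)) := by
        refine RegularAt.sum fun i' hi' => RegularAt.sum fun j _ =>
          regularAt_C_div_X_sub_C_pow ?_ _ _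
        simpa using hβ i i' (Finset.ne_of_mem_erase hi').symm 0
      rw [← hG, ← Finset.add_sum_erase _ _ (Finset.mem_univ i)] at h1
      simpa [add_sub_assoc] using (h1.sub (regularAt_C (β i) c)).sub h2
    refine ⟨eq_zero_of_C_eq_shift_sub_self hq0 hσ hreg ?_, hr⟩
    rw [← hG, Finset.sum_eq_zero, add_zero]
    intro i _
    exact Finset.sum_eq_zero fun j hj => by rw [hr i j hj, map_zero, zero_div]
  · rintro ⟨rfl, hr⟩
    rw [map_zero, zero_add]
    refine sum_mem fun i _ => sum_mem fun j hj => ?_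
    rw [hr i j hj, map_zero, zero_div]
    exact zero_mem _

end Telescoping


/-- Proposition 2.10: let `q ∈ K` be nonzero and not a root of unity and
`f = a/b ∈ K(x)` with `gcd(a,b)=1`.  Then `f` is rational `q`-summable in `K(x)`,
i.e. `f = g(qx) - g(x)` for some `g ∈ K(x)`, if and only if the `q`-discrete residue
of `f` at infinity is zero and all the `q`-discrete residues of `f` vanish.  Over the
algebraic closure, `f` decomposes uniquely as
`ι f = c + x·p₁ + p₂/x^s + ∑_i ∑_j ∑_{ℓ=0}^{d_{i,j}} α_{i,j,ℓ}/(x - q^ℓ β_i)^{j+1}`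
with `c ∈ K`, `p₁, p₂ ∈ K[x]`, `deg p₂ < s`, and the `β_i` nonzero and in distinct
`q^ℤ`-orbits; the `q`-discrete residue at the orbit `[β_i]_q` of multiplicity `j+1` is
`∑_ℓ q^{-ℓ(j+1)} α_{i,j,ℓ}` and the `q`-discrete residue at infinity is `c`. -/
theorem stmt4 {K : Type*} [Field K] [CharZero K]
    (q : K) (hq0 : q ≠ 0) (hq : ∀ n : ℕ, 0 < n → q ^ n ≠ 1)
    (a b : Polynomial K) (hb : b ≠ 0) (hab : IsCoprime a b)
    (f : RatFunc K)
    (hf : f = algebraMap (Polynomial K) (RatFunc K) a /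
              algebraMap (Polynomial K) (RatFunc K) b)
    (ι : RatFunc K →+* RatFunc (AlgebraicClosure K))
    (hιC : ∀ c : K, ι (RatFunc.C c) = RatFunc.C (algebraMap K (AlgebraicClosure K) c))
    (hιX : ι RatFunc.X = RatFunc.X)
    -- decomposition of `f` over the algebraic closure
    (c : K) (p₁ p₂ : Polynomial K) (s : ℕ) (hs : 1 ≤ s) (hp₂ : p₂.natDegree < s)
    (m : ℕ) (n : Fin m → ℕ) (d : (i : Fin m) → ℕ → ℕ)
    (α : (i : Fin m) → ℕ → ℕ → AlgebraicClosure K)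
    (β : Fin m → AlgebraicClosure K) (hβ0 : ∀ i, β i ≠ 0)
    (hβ : ∀ i i' : Fin m, i ≠ i' →
      ∀ z : ℤ, β i ≠ (algebraMap K (AlgebraicClosure K) q) ^ z * β i')
    (hdecomp : ι f = ι (RatFunc.C c +
          RatFunc.X * algebraMap (Polynomial K) (RatFunc K) p₁ +
          algebraMap (Polynomial K) (RatFunc K) p₂ / RatFunc.X ^ s) +
        ∑ i : Fin m, ∑ j ∈ Finset.range (n i), ∑ ℓ ∈ Finset.range (d i j + 1),
          RatFunc.C (α i j ℓ) /
            (RatFunc.X - RatFunc.C ((algebraMap K (AlgebraicClosure K) q) ^ ℓ * β i))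
              ^ (j + 1))
    -- the q-shift automorphism of `K(x)`
    (τ : RatFunc K →+* RatFunc K)
    (hτC : ∀ e : K, τ (RatFunc.C e) = RatFunc.C e)
    (hτX : τ RatFunc.X = RatFunc.C q * RatFunc.X) :
    (∃ g : RatFunc K, f = τ g - g) ↔
      (c = 0 ∧ ∀ (i : Fin m), ∀ j ∈ Finset.range (n i),
        ∑ ℓ ∈ Finset.range (d i j + 1),
          (algebraMap K (AlgebraicClosure K) q)⁻¹ ^ (ℓ * (j + 1)) * α i j ℓ = 0) := by
  set j := algebraMap K (AlgebraicClosure K)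
  have hQ0 : j q ≠ 0 := by simpa using hq0
  have hQ : ∀ n : ℕ, 0 < n → j q ^ n ≠ 1 := fun n hn h =>
    hq n hn (j.injective (by rw [map_pow, h, map_one]))
  have hτ : IsQShift q τ := ⟨hτC, hτX⟩
  obtain ⟨σ, hσ⟩ := exists_isQShift hQ0
  have hι (p : Polynomial K) : ι (algebraMap _ _ p) = algebraMap _ _ (p.map j) :=
    map_algebraMap_of_map_C_of_map_X hιC hιX p
  have hcomm (g : RatFunc K) : ι (τ g) = σ (ι g) := by
    rw [← RatFunc.num_div_denom g]
    simp only [map_div₀, hτ.map_algebraMap, hι, hσ.map_algebraMap]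
    simp [Polynomial.map_comp]
  have hdescent : (∃ g : RatFunc K, f = τ g - g) ↔ ι f ∈ summables σ := by
    rw [mem_summables]
    constructor
    · rintro ⟨g, hg⟩
      exact ⟨ι g, by rw [hg, map_sub, hcomm]⟩
    · rintro ⟨G, hG⟩
      exact exists_shift_sub_self_of_map hq0 hτ hσ hιC hιX hG
  set r : Fin m → ℕ → AlgebraicClosure K := fun i k =>
    ∑ ℓ ∈ Finset.range (d i k + 1), (j q)⁻¹ ^ (ℓ * (k + 1)) * α i k ℓ with hr
  have hresidue := sum_C_div_mem_summables_iff hQ0 hQ hσ n r β hβ0 hβ (j c)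
  rw [map_eq_zero] at hresidue
  rw [hdescent, ← hresidue]
  have hsimple : ∑ i, ∑ k ∈ Finset.range (n i),
      ((∑ ℓ ∈ Finset.range (d i k + 1), RatFunc.C (α i k ℓ) /
        (RatFunc.X - RatFunc.C (j q ^ ℓ * β i)) ^ (k + 1)) -
        RatFunc.C (r i k) / (RatFunc.X - RatFunc.C (β i)) ^ (k + 1)) ∈ summables σ := by
    refine sum_mem fun i _ => sum_mem fun k _ => ?_
    rw [hr, map_sum, Finset.sum_div, ← Finset.sum_sub_distrib]
    exact sum_mem fun ℓ _ => C_div_sub_C_div_mem_summables hQ0 hσ _ _ _ _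
  simp only [Finset.sum_sub_distrib] at hsimple
  have hlaurent := add_mem (X_mul_mem_summables hQ hσ (p₁.map j))
    (div_X_pow_mem_summables hQ hσ (p := p₂.map j) (by rwa [Polynomial.natDegree_map]))
  refine Iff.trans ?_ (add_mem_cancel_right (add_mem hlaurent hsimple))
  convert Iff.rfl using 2
  rw [hdecomp]
  simp only [map_add, map_mul, map_div₀, map_pow, hιC, hιX, hι]
  ring
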